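/- Let G be a finite simple graph and S ⊆ V a connected set with |S| ≥ 2 such that every block B of G[S] induces a complete graph G[B]. Then the number of ordered CCP-pairs of S equals Σ_{B block of G[S]} (2^{|B|} − 2). -/

import Mathlib

open SimpleGraph

variable {V : Type*}

/-- `(Sl, Sr)` is an ordered CCP-pair of `S` in graph `G`. -/
def CCP (G : SimpleGraph V) (S Sl Sr : Set V) : Prop :=
  Sl.Nonempty ∧ Sr.Nonempty ∧ Sl ∩ Sr = ∅ ∧ Sl ∪ Sr = S ∧
  (G.induce Sl).Connected ∧ (G.induce Sr).Connected ∧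
  ∃ a ∈ Sl, ∃ b ∈ Sr, G.Adj a b

/-- `B` is a block (maximal nonseparable subgraph) of `G[S]`. -/
def IsBlock (G : SimpleGraph V) (S B : Set V) : Prop :=
  B ⊆ S ∧ 2 ≤ B.ncard ∧ (G.induce B).Connected ∧
  (∀ v ∈ B, (G.induce (B \ {v})).Connected) ∧
  ∀ B' : Set V, B ⊆ B' → B' ⊆ S → 2 ≤ B'.ncard → (G.induce B').Connected →
    (∀ v ∈ B', (G.induce (B' \ {v})).Connected) → B' = B

/-- `grow G X Y` is the set of vertices of `Y` reachable in `G[Y]` from some vertex of `X`. -/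
def grow (G : SimpleGraph V) (X Y : Set V) : Set V :=
  {y | ∃ hy : y ∈ Y, ∃ x, ∃ hx : x ∈ Y, x ∈ X ∧ (G.induce Y).Reachable ⟨x, hx⟩ ⟨y, hy⟩}

/-- `y` can be reached from `x` by edges of `G` with both ends in `A`. -/
def ReachIn (G : SimpleGraph V) (A : Set V) : V → V → Prop :=
  Relation.ReflTransGen fun u v => G.Adj u v ∧ u ∈ A ∧ v ∈ A

section ReachIn

variable {G : SimpleGraph V} {A A' : Set V} {x y z : V}

lemma ReachIn.mono (h : A ⊆ A') (hr : ReachIn G A x y) : ReachIn G A' x y :=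
  Relation.ReflTransGen.mono (fun _ _ h' => ⟨h'.1, h h'.2.1, h h'.2.2⟩) _ _ hr

lemma ReachIn.symm (hr : ReachIn G A x y) : ReachIn G A y x := by
  induction hr with
  | refl => exact .refl
  | tail _ h ih => exact .head ⟨h.1.symm, h.2.2, h.2.1⟩ ih

lemma ReachIn.trans (h : ReachIn G A x y) (h' : ReachIn G A y z) : ReachIn G A x z :=
  Relation.ReflTransGen.trans h h'

lemma SimpleGraph.Adj.reachIn (h : G.Adj x y) (hx : x ∈ A) (hy : y ∈ A) : ReachIn G A x y :=
  .single ⟨h, hx, hy⟩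

lemma ReachIn.mem (hr : ReachIn G A x y) (hx : x ∈ A) : y ∈ A := by
  cases hr with
  | refl => exact hx
  | tail _ h => exact h.2.2

lemma ReachIn.exists_walk (hr : ReachIn G A x y) (hx : x ∈ A) :
    ∃ p : G.Walk x y, ∀ w ∈ p.support, w ∈ A := by
  induction hr using Relation.ReflTransGen.head_induction_on with
  | refl => exact ⟨.nil, by simpa using hx⟩
  | head h _ ih =>
    obtain ⟨p, hp⟩ := ih h.2.2
    exact ⟨.cons h.1 p, by simpa using ⟨hx, hp⟩⟩

lemma SimpleGraph.Walk.reachIn (p : G.Walk x y) (h : ∀ w ∈ p.support, w ∈ A) :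
    ReachIn G A x y := by
  induction p with
  | nil => exact .refl
  | cons hadj p ih =>
    simp only [Walk.support_cons, List.mem_cons, forall_eq_or_imp] at h
    exact .head ⟨hadj, h.1, h.2 _ p.start_mem_support⟩ (ih h.2)

lemma induce_connected_iff :
    (G.induce A).Connected ↔ A.Nonempty ∧ ∀ x ∈ A, ∀ y ∈ A, ReachIn G A x y := by
  rw [SimpleGraph.connected_iff, and_comm, Set.nonempty_coe_sort]
  refine and_congr_right fun _ => ⟨fun h x hx y hy => ?_, fun h x y => ?_⟩
  · obtain ⟨p⟩ := h ⟨x, hx⟩ ⟨y, hy⟩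
    refine (p.map (Embedding.induce A).toHom).reachIn fun w hw => ?_
    rw [Walk.support_map, List.mem_map] at hw
    obtain ⟨a, -, rfl⟩ := hw
    exact a.2
  · obtain ⟨p, hp⟩ := (h x x.2 y y.2).exists_walk x.2
    exact ⟨p.induce A hp⟩

/-- A set is connected as soon as each of its vertices reaches a given connected subset. -/
lemma induce_connected_of_reachIn (hA : (G.induce A).Connected) (hsub : A ⊆ A')
    (h : ∀ w ∈ A', ∃ a ∈ A, ReachIn G A' w a) : (G.induce A').Connected := by
  rw [induce_connected_iff] at hA ⊢
  refine ⟨hA.1.mono hsub, fun x hx y hy => ?_⟩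
  obtain ⟨a, ha, hxa⟩ := h x hx
  obtain ⟨b, hb, hyb⟩ := h y hy
  exact hxa.trans (((hA.2 a ha b hb).mono hsub).trans hyb.symm)

end ReachIn

section Block

variable {G : SimpleGraph V} {S B B' C Sl Sr : Set V} {u v x y : V}

lemma IsBlock.connected_diff (hB : IsBlock G S B) (v : V) :
    (G.induce (B \ {v})).Connected := by
  by_cases hv : v ∈ B
  · exact hB.2.2.2.1 v hv
  · rw [Set.sdiff_singleton_eq_self hv]
    exact hB.2.2.1

/-- A block absorbs every set that stays attached to it after deleting any vertex. -/
lemma IsBlock.subset_of_attached [Finite V] (hB : IsBlock G S B) {T : Set V} (hT : T ⊆ S)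
    (h : ∀ v, ∀ w ∈ T, w ≠ v → ∃ b ∈ B, b ≠ v ∧ ReachIn G ((B ∪ T) \ {v}) w b) : T ⊆ B := by
  have key : B ∪ T = B := by
    refine hB.2.2.2.2 _ Set.subset_union_left (Set.union_subset hB.1 hT)
      (hB.2.1.trans (Set.ncard_le_ncard Set.subset_union_left (Set.toFinite _))) ?_ ?_
    · refine induce_connected_of_reachIn hB.2.2.1 Set.subset_union_left ?_
      rintro w (hw | hw)
      · exact ⟨w, hw, .refl⟩
      · obtain ⟨v, -, hv⟩ := Set.exists_ne_of_one_lt_ncard hB.2.1 w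
        obtain ⟨b, hb, -, hr⟩ := h v w hw hv.symm
        exact ⟨b, hb, hr.mono Set.sdiff_subset⟩
    · intro v _
      refine induce_connected_of_reachIn (hB.connected_diff v)
        (Set.sdiff_subset_sdiff_left Set.subset_union_left) ?_
      rintro w ⟨hw | hw, hwv⟩
      · exact ⟨w, ⟨hw, hwv⟩, .refl⟩
      · obtain ⟨b, hb, hbv, hr⟩ := h v w hw hwv
        exact ⟨b, ⟨hb, hbv⟩, hr⟩
  exact Set.union_eq_left.mp key

lemma IsBlock.eq_of_two_mem [Finite V] (hB : IsBlock G S B) (hB' : IsBlock G S B') (hne : x ≠ y)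
    (hx : x ∈ B) (hy : y ∈ B) (hx' : x ∈ B') (hy' : y ∈ B') : B = B' := by
  have aux : ∀ {B₁ B₂ : Set V}, IsBlock G S B₁ → IsBlock G S B₂ → x ∈ B₁ → y ∈ B₁ →
      x ∈ B₂ → y ∈ B₂ → B₂ ⊆ B₁ := by
    intro B₁ B₂ h₁ h₂ hx₁ hy₁ hx₂ hy₂
    refine h₁.subset_of_attached h₂.1 fun v w hw hwv => ?_
    have hr := (induce_connected_iff.mp (h₂.connected_diff v)).2 w ⟨hw, hwv⟩
    have hsub : B₂ \ {v} ⊆ (B₁ ∪ B₂) \ {v} :=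
      Set.sdiff_subset_sdiff_left Set.subset_union_right
    by_cases hxv : x = v
    · have hyv : y ≠ v := fun h => hne (hxv.trans h.symm)
      exact ⟨y, hy₁, hyv, (hr y ⟨hy₂, hyv⟩).mono hsub⟩
    · exact ⟨x, hx₁, hxv, (hr x ⟨hx₂, hxv⟩).mono hsub⟩
  exact (aux hB' hB hx' hy' hx hy).antisymm (aux hB hB' hx hy hx' hy')

/-- A path in `G[S]` between vertices of a block stays in the block. -/
lemma IsBlock.support_subset [Finite V] (hB : IsBlock G S B) (hx : x ∈ B) (hy : y ∈ B)
    {p : G.Walk x y} (hp : p.IsPath) (hS : ∀ w ∈ p.support, w ∈ S) :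
    ∀ w ∈ p.support, w ∈ B := by
  classical
  refine hB.subset_of_attached (T := {w | w ∈ p.support}) hS fun v w hw hwv => ?_
  have hw' : w ∈ p.support := hw
  by_cases hv : v ∈ (p.takeUntil w hw').support
  · have hv' : v ∉ (p.dropUntil w hw').support := by
      intro hv'
      have hnd := hp.support_nodup
      rw [← p.take_spec hw', Walk.support_append] at hnd
      have hd := (List.nodup_append.mp hnd).2.2
      rw [← Walk.cons_tail_support, List.mem_cons] at hv'
      exact hd v hv v (hv'.resolve_left hwv.symm) rfl
    refine ⟨y, hy, fun h => hv' (h ▸ Walk.end_mem_support _), (p.dropUntil w hw').reachIn ?_⟩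
    exact fun z hz => ⟨Or.inr (p.support_dropUntil_subset_support hw' hz), fun h => hv' (h ▸ hz)⟩
  · refine ⟨x, hx, fun h => hv (h ▸ Walk.start_mem_support _),
      ((p.takeUntil w hw').reachIn ?_).symm⟩
    exact fun z hz => ⟨Or.inr (p.support_takeUntil_subset_support hw' hz), fun h => hv (h ▸ hz)⟩

lemma exists_isBlock_of_adj [Finite V] (hx : x ∈ S) (hy : y ∈ S) (h : G.Adj x y) :
    ∃ B, IsBlock G S B ∧ x ∈ B ∧ y ∈ B := by
  let P : Set V → Prop := fun B => B ⊆ S ∧ 2 ≤ B.ncard ∧ (G.induce B).Connected ∧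
    ∀ v ∈ B, (G.induce (B \ {v})).Connected
  have hsingle : ∀ z : V, (G.induce {z}).Connected := by
    intro z
    rw [induce_connected_iff]
    refine ⟨Set.singleton_nonempty z, ?_⟩
    rintro _ rfl _ rfl
    exact .refl
  have hP : P {x, y} := by
    refine ⟨Set.pair_subset hx hy, (Set.ncard_pair h.ne).ge, ?_, ?_⟩
    · refine induce_connected_of_reachIn (hsingle x) (by simp) ?_
      rintro w (rfl | rfl)
      · exact ⟨w, rfl, .refl⟩
      · exact ⟨x, rfl, h.symm.reachIn (by simp) (by simp)⟩
    · rintro v (rfl | rfl)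
      · rw [Set.pair_sdiff_left h.ne]
        exact hsingle y
      · rw [Set.pair_sdiff_right h.ne]
        exact hsingle x
  obtain ⟨B, hle, hB⟩ := (Set.toFinite {B | P B}).exists_le_maximal hP
  refine ⟨B, ⟨hB.prop.1, hB.prop.2.1, hB.prop.2.2.1, hB.prop.2.2.2, ?_⟩,
    hle (by simp), hle (by simp)⟩
  intro B' hsub h1 h2 h3 h4
  exact (hB.eq_of_le ⟨h1, h2, h3, h4⟩ hsub).symm

/-- `x` is a gate of `v` in `B`: `v` is reached from `x` in `G[S]` avoiding the rest of `B`. -/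
def IsGate (G : SimpleGraph V) (S B : Set V) (x v : V) : Prop :=
  x ∈ B ∧ ReachIn G (S \ (B \ {x})) x v

lemma IsGate.mem (hB : B ⊆ S) (h : IsGate G S B x v) : v ∈ S \ (B \ {x}) :=
  h.2.mem ⟨hB h.1, by simp⟩

lemma isGate_self (hx : x ∈ B) : IsGate G S B x x := ⟨hx, .refl⟩

lemma IsGate.eq_of_mem (hB : B ⊆ S) (h : IsGate G S B x v) (hv : v ∈ B) : v = x := by
  by_contra hne
  exact (h.mem hB).2 ⟨hv, hne⟩

lemma IsGate.unique [Finite V] (hB : IsBlock G S B) (hx : IsGate G S B x v)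
    (hy : IsGate G S B y v) : x = y := by
  classical
  by_contra hne
  obtain ⟨p, hp⟩ := hx.2.exists_walk ⟨hB.1 hx.1, by simp⟩
  obtain ⟨q, hq⟩ := hy.2.exists_walk ⟨hB.1 hy.1, by simp⟩
  have hyp : y ∉ p.support := fun h => (hp y h).2 ⟨hy.1, fun h => hne h.symm⟩
  have hxq : x ∉ q.support := fun h => (hq x h).2 ⟨hx.1, hne⟩
  let W := p.append q.reverse
  have hW : ∀ w ∈ W.support, w ∈ S ∧ (w ∈ B → w = x ∨ w = y) := by
    intro w hw
    rw [Walk.mem_support_append_iff, Walk.support_reverse, List.mem_reverse] at hw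
    rcases hw with hw | hw
    · exact ⟨(hp w hw).1, fun h => .inl (by_contra fun h' => (hp w hw).2 ⟨h, h'⟩)⟩
    · exact ⟨(hq w hw).1, fun h => .inr (by_contra fun h' => (hq w hw).2 ⟨h, h'⟩)⟩
  have hsub := W.support_bypass_subset_support
  have hin := hB.support_subset hx.1 hy.1 W.bypass_isPath fun w hw => (hW w (hsub hw)).1
  have hedges := W.edges_bypass_subset_edges
  generalize W.bypass = r at hsub hin hedges
  cases r with
  | nil => exact hne rfl
  | @cons _ z _ hadj r =>
    have hz : z ∈ (Walk.cons hadj r).support := by simp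
    obtain rfl | rfl := (hW z (hsub hz)).2 (hin z hz)
    · exact hadj.ne rfl
    · have he : s(x, z) ∈ W.edges := hedges (by simp)
      rw [Walk.edges_append, List.mem_append, Walk.edges_reverse, List.mem_reverse] at he
      rcases he with he | he
      · exact hyp (p.snd_mem_support_of_mem_edges he)
      · exact hxq (q.fst_mem_support_of_mem_edges he)

lemma IsGate.of_adj (hB : B ⊆ S) (h : IsGate G S B x u) (hadj : G.Adj u v) (hvS : v ∈ S)
    (hv : v ∉ B) : IsGate G S B x v :=
  ⟨h.1, h.2.trans (hadj.reachIn (h.mem hB) ⟨hvS, fun h => hv h.1⟩)⟩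

/-- A connected part of `S` meeting `B` contains, for each of its vertices, a gate. -/
lemma exists_isGate_mem (hB : B ⊆ S) (hSl : Sl ⊆ S) (hc : (G.induce Sl).Connected)
    (hne : (Sl ∩ B).Nonempty) (hv : v ∈ Sl) : ∃ x ∈ Sl, IsGate G S B x v := by
  obtain ⟨b, hb, hbB⟩ := hne
  have hr := (induce_connected_iff.mp hc).2 b hb v hv
  induction hr with
  | refl => exact ⟨b, hb, isGate_self hbB⟩
  | @tail u w _ h ih =>
    by_cases hw : w ∈ B
    · exact ⟨w, hv, isGate_self hw⟩
    · obtain ⟨x, hx, hg⟩ := ih h.2.1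
      exact ⟨x, hx, hg.of_adj hB h.1 (hSl hv) hw⟩

/-- The vertices with a gate in `C`. -/
def gateSide (G : SimpleGraph V) (S B C : Set V) : Set V :=
  {v | ∃ x ∈ C, IsGate G S B x v}

lemma gateSide_inter (hB : B ⊆ S) (hC : C ⊆ B) : gateSide G S B C ∩ B = C := by
  ext v
  constructor
  · rintro ⟨⟨x, hx, hg⟩, hv⟩
    rwa [hg.eq_of_mem hB hv]
  · exact fun hv => ⟨⟨v, hv, isGate_self (hC hv)⟩, hC hv⟩

lemma gateSide_connected (hcomp : ∀ a ∈ B, ∀ b ∈ B, a ≠ b → G.Adj a b)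
    (hC : C ⊆ B) (hne : C.Nonempty) : (G.induce (gateSide G S B C)).Connected := by
  have hself : C ⊆ gateSide G S B C := fun v hv => ⟨v, hv, isGate_self (hC hv)⟩
  have hCc : (G.induce C).Connected := by
    refine induce_connected_iff.mpr ⟨hne, fun x hx y hy => ?_⟩
    by_cases h : x = y
    · exact h ▸ .refl
    · exact (hcomp x (hC hx) y (hC hy) h).reachIn hx hy
  refine induce_connected_of_reachIn hCc hself ?_
  rintro w ⟨x, hx, hxB, hr⟩
  refine ⟨x, hx, ReachIn.symm ?_⟩
  induction hr with
  | refl => exact .refl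
  | @tail a b hab h ih =>
    exact ih.trans (h.1.reachIn ⟨x, hx, hxB, hab⟩ ⟨x, hx, hxB, hab.tail h⟩)

lemma CCP.left_subset (h : CCP G S Sl Sr) : Sl ⊆ S :=
  h.2.2.2.1 ▸ Set.subset_union_left

lemma CCP.right_subset (h : CCP G S Sl Sr) : Sr ⊆ S :=
  h.2.2.2.1 ▸ Set.subset_union_right

lemma CCP.notMem_right (h : CCP G S Sl Sr) (hx : x ∈ Sl) : x ∉ Sr := fun hx' =>
  Set.notMem_empty x (h.2.2.1 ▸ ⟨hx, hx'⟩)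

lemma ccp_gateSide [Finite V] (hconn : (G.induce S).Connected) (hB : IsBlock G S B)
    (hcomp : ∀ a ∈ B, ∀ b ∈ B, a ≠ b → G.Adj a b) (hC : C ⊆ B) (hne : C.Nonempty)
    (hCB : C ≠ B) : CCP G S (gateSide G S B C) (gateSide G S B (B \ C)) := by
  have hne' : (B \ C).Nonempty := Set.nonempty_of_ssubset (hC.ssubset_of_ne hCB)
  have hself : ∀ {D : Set V}, D ⊆ B → D ⊆ gateSide G S B D :=
    fun hD v hv => ⟨v, hv, isGate_self (hD hv)⟩
  refine ⟨hne.mono (hself hC), hne'.mono (hself Set.sdiff_subset), ?_, ?_,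
    gateSide_connected hcomp hC hne, gateSide_connected hcomp Set.sdiff_subset hne', ?_⟩
  · rw [Set.eq_empty_iff_forall_notMem]
    rintro v ⟨⟨x, hx, hgx⟩, y, hy, hgy⟩
    exact hy.2 (hgx.unique hB hgy ▸ hx)
  · ext v
    constructor
    · rintro (⟨x, -, hg⟩ | ⟨x, -, hg⟩) <;> exact (hg.mem hB.1).1
    · intro hv
      have hBne : (S ∩ B).Nonempty := (hne.mono hC).mono fun b hb => ⟨hB.1 hb, hb⟩
      obtain ⟨x, -, hg⟩ := exists_isGate_mem hB.1 subset_rfl hconn hBne hv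
      by_cases hx : x ∈ C
      · exact .inl ⟨x, hx, hg⟩
      · exact .inr ⟨x, ⟨hg.1, hx⟩, hg⟩
  · obtain ⟨a, ha⟩ := hne
    obtain ⟨b, hb⟩ := hne'
    exact ⟨a, hself hC ha, b, hself Set.sdiff_subset hb,
      hcomp a (hC ha) b hb.1 fun h => hb.2 (h ▸ ha)⟩

lemma CCP.symm (h : CCP G S Sl Sr) : CCP G S Sr Sl := by
  obtain ⟨h1, h2, h3, h4, h5, h6, a, ha, b, hb, hab⟩ := h
  exact ⟨h2, h1, Set.inter_comm Sl Sr ▸ h3, Set.union_comm Sl Sr ▸ h4, h6, h5,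
    b, hb, a, ha, hab.symm⟩

lemma CCP.left_eq_gateSide [Finite V] (h : CCP G S Sl Sr) (hB : IsBlock G S B)
    (hl : (Sl ∩ B).Nonempty) (hr : (Sr ∩ B).Nonempty) : gateSide G S B (Sl ∩ B) = Sl := by
  ext v
  constructor
  · rintro ⟨x, hx, hg⟩
    by_contra hv
    have hv' : v ∈ Sr := (h.2.2.2.1.symm ▸ (hg.mem hB.1).1 : v ∈ Sl ∪ Sr).resolve_left hv
    obtain ⟨y, hy, hg'⟩ := exists_isGate_mem hB.1 h.right_subset h.2.2.2.2.2.1 hr hv'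
    exact h.notMem_right hx.1 (hg.unique hB hg' ▸ hy)
  · intro hv
    obtain ⟨x, hx, hg⟩ := exists_isGate_mem hB.1 h.left_subset h.2.2.2.2.1 hl hv
    exact ⟨x, ⟨hx, hg.1⟩, hg⟩

/-- At most one block meets both sides of a CCP-pair. -/
lemma CCP.block_unique [Finite V] (h : CCP G S Sl Sr) (hB : IsBlock G S B)
    (hB' : IsBlock G S B') (hcomp : ∀ a ∈ B', ∀ b ∈ B', a ≠ b → G.Adj a b)
    (hl : (Sl ∩ B).Nonempty) (hr : (Sr ∩ B).Nonempty)
    (hl' : (Sl ∩ B').Nonempty) (hr' : (Sr ∩ B').Nonempty) : B = B' := by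
  obtain ⟨a, ha, haB'⟩ := hl'
  obtain ⟨b, hb, hbB'⟩ := hr'
  have hab : a ≠ b := fun e => h.notMem_right ha (e ▸ hb)
  have hadj := hcomp a haB' b hbB' hab
  obtain ⟨x, hx, hgx⟩ := exists_isGate_mem hB.1 h.left_subset h.2.2.2.2.1 hl ha
  obtain ⟨y, hy, hgy⟩ := exists_isGate_mem hB.1 h.right_subset h.2.2.2.2.2.1 hr hb
  have hxy : x ≠ y := fun e => h.notMem_right hx (e ▸ hy)
  have haB : a ∈ B := by
    by_contra ha'
    exact hxy (hgx.unique hB (hgy.of_adj hB.1 hadj.symm (h.left_subset ha) ha'))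
  have hbB : b ∈ B := by
    by_contra hb'
    exact hxy ((hgx.of_adj hB.1 hadj (h.right_subset hb) hb').unique hB hgy)
  exact hB.eq_of_two_mem hB' hab haB hbB haB' hbB'

end Block

lemma card_nonempty_proper_subsets [Finite V] {B : Set V} (hB : B.Nonempty) :
    Nat.card {C : Set V // C ⊆ B ∧ C.Nonempty ∧ C ≠ B} = 2 ^ B.ncard - 2 := by
  have h : {C : Set V | C ⊆ B ∧ C.Nonempty ∧ C ≠ B} = 𝒫 B \ {∅, B} := by
    ext C
    simp [Set.nonempty_iff_ne_empty]
  change Nat.card ({C : Set V | C ⊆ B ∧ C.Nonempty ∧ C ≠ B} : Set (Set V)) = _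
  rw [Nat.card_coe_set_eq, h, Set.ncard_sdiff (by simp [Set.pair_subset_iff]),
    Set.ncard_powerset B, Set.ncard_pair hB.ne_empty.symm]

/-- For connected `S` with `|S| ≥ 2` all of whose blocks induce complete
graphs, the number of ordered CCP-pairs of `S` equals `Σ_{B block} (2^{|B|} − 2)`. -/
theorem stmt15 [Fintype V] (G : SimpleGraph V) (S : Set V)
    (hconn : (G.induce S).Connected) (h2 : 2 ≤ S.ncard)
    (hcomp : ∀ B : Set V, IsBlock G S B → ∀ a ∈ B, ∀ b ∈ B, a ≠ b → G.Adj a b) :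
    Nat.card {p : Set V × Set V // CCP G S p.1 p.2} =
      ∑ᶠ B ∈ {B : Set V | IsBlock G S B}, (2 ^ B.ncard - 2) := by
  classical
  let f : (Σ B : {B : Set V | IsBlock G S B}, {C : Set V // C ⊆ B.1 ∧ C.Nonempty ∧ C ≠ B.1}) →
      {p : Set V × Set V // CCP G S p.1 p.2} := fun z =>
    ⟨(gateSide G S z.1 z.2, gateSide G S z.1 (z.1 \ z.2)),
      ccp_gateSide hconn z.1.2 (hcomp _ z.1.2) z.2.2.1 z.2.2.2.1 z.2.2.2.2⟩
  have hf : Function.Bijective f := by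
    constructor
    · rintro ⟨⟨B, hB⟩, C, hC, hne, hCB⟩ ⟨⟨B', hB'⟩, C', hC', hne', hCB'⟩ heq
      have hl : gateSide G S B C = gateSide G S B' C' :=
        congrArg (fun p => p.1.1) heq
      have hr : gateSide G S B (B \ C) = gateSide G S B' (B' \ C') :=
        congrArg (fun p => p.1.2) heq
      have hccp := ccp_gateSide hconn hB (hcomp B hB) hC hne hCB
      obtain rfl : B = B' := by
        refine hccp.block_unique hB hB' (hcomp B' hB') ?_ ?_ ?_ ?_
        · rwa [gateSide_inter hB.1 hC]
        · rw [gateSide_inter hB.1 Set.sdiff_subset]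
          exact Set.nonempty_of_ssubset (hC.ssubset_of_ne hCB)
        · rwa [hl, gateSide_inter hB'.1 hC']
        · rw [hr, gateSide_inter hB'.1 Set.sdiff_subset]
          exact Set.nonempty_of_ssubset (hC'.ssubset_of_ne hCB')
      obtain rfl : C = C' := by
        rw [← gateSide_inter (G := G) hB.1 hC, hl, gateSide_inter hB.1 hC']
      rfl
    · rintro ⟨⟨Sl, Sr⟩, h⟩
      have h' : CCP G S Sl Sr := h
      obtain ⟨a, ha, b, hb, hab⟩ := h'.2.2.2.2.2.2
      obtain ⟨B, hB, haB, hbB⟩ :=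
        exists_isBlock_of_adj (h'.left_subset ha) (h'.right_subset hb) hab
      have hl : (Sl ∩ B).Nonempty := ⟨a, ha, haB⟩
      have hr : (Sr ∩ B).Nonempty := ⟨b, hb, hbB⟩
      have hdiff : B \ (Sl ∩ B) = Sr ∩ B := by
        ext v
        constructor
        · rintro ⟨hv, hv'⟩
          exact ⟨(h'.2.2.2.1.symm ▸ hB.1 hv : v ∈ Sl ∪ Sr).resolve_left
            fun hvl => hv' ⟨hvl, hv⟩, hv⟩
        · exact fun hv => ⟨hv.2, fun hv' => h'.notMem_right hv'.1 hv.1⟩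
      refine ⟨⟨⟨B, hB⟩, Sl ∩ B, Set.inter_subset_right, hl, fun e => ?_⟩, ?_⟩
      · exact h'.notMem_right (e.symm ▸ hbB : b ∈ Sl ∩ B).1 hb
      · refine Subtype.ext (Prod.ext ?_ ?_)
        · exact h'.left_eq_gateSide hB hl hr
        · change gateSide G S B (B \ (Sl ∩ B)) = Sr
          rw [hdiff]
          exact h'.symm.left_eq_gateSide hB hr hl
  rw [← Nat.card_congr (Equiv.ofBijective f hf), Nat.card_sigma,
    ← finsum_set_coe_eq_finsum_mem, finsum_eq_sum_of_fintype]
  refine Finset.sum_congr rfl fun B _ => card_nonempty_proper_subsets ?_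
  exact Set.nonempty_of_ncard_ne_zero (by have := B.2.2.1; omega)
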